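/- Let P be a simple polygon and k ≥ 1 an integer. If P has a witness set of cardinality k, then P has a witness set of cardinality k that contains at least one vertex of the polygon P. -/

import Mathlib

open Set

noncomputable section

abbrev Plane := EuclideanSpace ℝ (Fin 2)

/-- A simple polygon, given by a cyclic sequence of at least three distinct vertices
whose closed polygonal boundary curve is a Jordan polygon: two edges intersect exactly
when they are consecutive, and then only in their one shared endpoint. -/
structure SimplePolygon where
  n : ℕ
  three_le : 3 ≤ n
  vertex : ℕ → Plane
  periodic : ∀ i, vertex (i + n) = vertex i
  inj : ∀ i < n, ∀ j < n, vertex i = vertex j → i = j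
  jordan : ∀ i < n, ∀ j < n, i ≠ j →
    segment ℝ (vertex i) (vertex (i + 1)) ∩ segment ℝ (vertex j) (vertex (j + 1)) =
      if j = (i + 1) % n then {vertex (i + 1)}
      else if i = (j + 1) % n then {vertex (j + 1)}
      else ∅

namespace SimplePolygon

/-- The boundary curve of the polygon: the union of its edges. -/
def boundary (P : SimplePolygon) : Set Plane :=
  ⋃ i ∈ Finset.range P.n, segment ℝ (P.vertex i) (P.vertex (i + 1))

/-- The polygon as a region: the boundary together with all bounded connected
components of the complement of the boundary. -/
def region (P : SimplePolygon) : Set Plane :=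
  P.boundary ∪ {x | x ∉ P.boundary ∧
    Bornology.IsBounded (connectedComponentIn P.boundaryᶜ x)}

/-- Visibility region of a point `p`: all points `q` of the polygon such that the
closed segment `[p,q]` is contained in the polygon. -/
def Vis (P : SimplePolygon) (p : Plane) : Set Plane :=
  {q | q ∈ P.region ∧ segment ℝ p q ⊆ P.region}

/-- Visibility region of a set. -/
def VisSet (P : SimplePolygon) (S : Set Plane) : Set Plane :=
  ⋃ p ∈ S, P.Vis p

/-- Two points of the polygon are visible to each other if the segment joining them
lies in the polygon. -/
def Visible (P : SimplePolygon) (p q : Plane) : Prop :=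
  p ∈ P.region ∧ q ∈ P.region ∧ segment ℝ p q ⊆ P.region

/-- A witness set: a finite set of points of the polygon with pairwise disjoint
visibility regions. -/
def IsWitnessSet (P : SimplePolygon) (W : Set Plane) : Prop :=
  W.Finite ∧ W ⊆ P.region ∧
    ∀ x ∈ W, ∀ y ∈ W, x ≠ y → P.Vis x ∩ P.Vis y = ∅

/-- The non-visible region of a witness set. -/
def NVis (P : SimplePolygon) (W : Set Plane) : Set Plane :=
  P.region \ ⋃ w ∈ W, P.Vis w

/-- `Vis p` is regular (has no arms) if it equals the closure of its interior. -/
def VisRegular (P : SimplePolygon) (p : Plane) : Prop :=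
  P.Vis p = closure (interior (P.Vis p))

/-- A window of `Vis p`: a non-degenerate closed segment contained in the frontier of
`Vis p` whose intersection with the frontier of the polygon is exactly its two
endpoints, maximal with these properties. -/
def IsWindow (P : SimplePolygon) (p : Plane) (e : Set Plane) : Prop :=
  ∃ a b : Plane, a ≠ b ∧ e = segment ℝ a b ∧
    e ⊆ frontier (P.Vis p) ∧
    e ∩ frontier P.region = {a, b} ∧
    ∀ a' b' : Plane, a' ≠ b' →
      segment ℝ a' b' ⊆ frontier (P.Vis p) →
      segment ℝ a' b' ∩ frontier P.region = {a', b'} →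
      e ⊆ segment ℝ a' b' → e = segment ℝ a' b'

/-- `γ` is (the image of) a neighbor witness path between `w` and `w'`. -/
def IsNWPath (P : SimplePolygon) (W : Set Plane) (w w' : Plane) (γ : Set Plane) : Prop :=
  ∃ f : Path w w', γ = Set.range f ∧ γ ⊆ P.Vis w ∪ P.NVis W ∪ P.Vis w'

/-- Adjacency in the neighbor witness graph `GCon(W)`. -/
def GConAdj (P : SimplePolygon) (W : Set Plane) (w w' : Plane) : Prop :=
  w ∈ W ∧ w' ∈ W ∧ w ≠ w' ∧ ∃ γ : Set Plane, P.IsNWPath W w w' γ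

/-- A connected component `NV` of `NVis W` is attached to `Vis w` if the closure of
`NV` intersects `Vis w`. -/
def Attached (P : SimplePolygon) (NV : Set Plane) (w : Plane) : Prop :=
  (closure NV ∩ P.Vis w).Nonempty

/-- `w` is a simplicial vertex of `GCon(W)`: its neighbors are pairwise adjacent. -/
def Simplicial (P : SimplePolygon) (W : Set Plane) (w : Plane) : Prop :=
  ∀ u v : Plane, P.GConAdj W w u → P.GConAdj W w v → u ≠ v → P.GConAdj W u v

end SimplePolygon

/-- `NV` is a connected component of `S`. -/
def IsCompOf (NV S : Set Plane) : Prop :=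
  ∃ x ∈ S, NV = connectedComponentIn S x

theorem isCompact_segment {E : Type*} [AddCommGroup E] [Module ℝ E] [TopologicalSpace E]
    [ContinuousAdd E] [ContinuousSMul ℝ E] (a b : E) : IsCompact (segment ℝ a b) := by
  rw [segment_eq_image]
  exact isCompact_Icc.image (by fun_prop)

theorem exp_lift_sub_eq {X : Set ℂ} (hX : IsPreconnected X) {g₁ g₂ : ℂ → ℂ}
    (h₁ : ContinuousOn g₁ X) (h₂ : ContinuousOn g₂ X)
    (h : ∀ z ∈ X, Complex.exp (g₁ z) = Complex.exp (g₂ z)) {a b : ℂ} (ha : a ∈ X) (hb : b ∈ X) :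
    g₁ a - g₂ a = g₁ b - g₂ b := by
  have key : ∀ z ∈ X, ∃ n : ℤ, g₁ z - g₂ z = n * (2 * Real.pi * Complex.I) := by
    intro z hz
    obtain ⟨n, hn⟩ := Complex.exp_eq_exp_iff_exists_int.1 (h z hz)
    exact ⟨n, by rw [hn]; ring⟩
  have hc : ContinuousOn (fun z => (g₁ z - g₂ z).im / (2 * Real.pi)) X :=
    (Complex.continuous_im.comp_continuousOn (h₁.sub h₂)).div_const _
  have hT : DiscreteTopology (range ((↑) : ℤ → ℝ)) :=
    Int.isClosedEmbedding_coe_real.isEmbedding.toHomeomorph.symm.isEmbedding.discreteTopology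
  have hm : MapsTo (fun z => (g₁ z - g₂ z).im / (2 * Real.pi)) X (range ((↑) : ℤ → ℝ)) := by
    intro z hz
    obtain ⟨n, hn⟩ := key z hz
    refine ⟨n, ?_⟩
    simp only [hn]
    simp
  have e := hX.constant_of_mapsTo ⟨hT⟩ hc hm ha hb
  obtain ⟨n, hn⟩ := key a ha
  obtain ⟨m, hm⟩ := key b hb
  rw [hn, hm] at e ⊢
  simp at e
  rw [e]

/-- A compact plane set on which every `z ↦ z - p` with `p` outside the set has a continuous
logarithm. -/
structure HasLogs (K : Set ℂ) : Prop where
  isCompact : IsCompact K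
  exists_log : ∀ p ∉ K, ∃ g : ℂ → ℂ, ContinuousOn g K ∧ ∀ z ∈ K, Complex.exp (g z) = z - p

theorem exists_log_div_of_dist_lt {K : Set ℂ} {p q : ℂ} {r : ℝ} (hr : ∀ z ∈ K, r ≤ dist z p)
    (hq : dist q p < r) :
    ∃ g : ℂ → ℂ, ContinuousOn g K ∧ ∀ z ∈ K, Complex.exp (g z) = (z - q) / (z - p) := by
  have hne : ∀ z ∈ K, z - p ≠ 0 := fun z hz h => by
    have := hr z hz
    rw [dist_eq_norm, h, norm_zero] at this
    linarith [dist_nonneg (x := q) (y := p)]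
  have hs : ∀ z ∈ K, (z - q) / (z - p) ∈ Complex.slitPlane := by
    intro z hz
    apply Complex.ball_one_subset_slitPlane
    rw [Metric.mem_ball, dist_eq_norm, div_sub_one (hne z hz), norm_div,
      div_lt_one (norm_pos_iff.2 (hne z hz))]
    have := hr z hz
    rw [dist_eq_norm] at this hq
    rw [show z - q - (z - p) = -(q - p) by ring, norm_neg]
    linarith
  refine ⟨fun z => Complex.log ((z - q) / (z - p)), ?_, ?_⟩
  · refine ContinuousOn.clog ?_ hs
    exact (continuousOn_id.sub continuousOn_const).div (continuousOn_id.sub continuousOn_const) hne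
  · intro z hz
    exact Complex.exp_log (Complex.slitPlane_ne_zero (hs z hz))

theorem HasLogs.of_unbounded {K : Set ℂ} (hK : IsCompact K)
    (h : ∀ p ∉ K, ∃ Ω : Set ℂ, p ∈ Ω ∧ Ω ⊆ Kᶜ ∧ IsPreconnected Ω ∧ ¬ Bornology.IsBounded Ω) :
    HasLogs K := by
  refine ⟨hK, fun p hp => ?_⟩
  obtain ⟨Ω, hpΩ, hΩK, hΩ, hub⟩ := h p hp
  obtain ⟨R, hR0, hR⟩ := hK.isBounded.exists_pos_norm_lt
  obtain ⟨q, hqΩ, hq⟩ : ∃ q ∈ Ω, R < ‖q‖ := by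
    by_contra! hcon
    exact hub (isBounded_iff_forall_norm_le.2 ⟨R, hcon⟩)
  have hdiv : ∃ g : ℂ → ℂ, ContinuousOn g K ∧ ∀ z ∈ K, Complex.exp (g z) = (z - p) / (z - q) := by
    refine hΩ.induction₂ (fun a b => ∃ g : ℂ → ℂ, ContinuousOn g K ∧
      ∀ z ∈ K, Complex.exp (g z) = (z - a) / (z - b)) ?_ ?_ ?_ hpΩ hqΩ
    · intro a ha
      obtain ⟨r, hr, hball⟩ := Metric.isOpen_iff.1 hK.isClosed.isOpen_compl a (hΩK ha)
      filter_upwards [mem_nhdsWithin_of_mem_nhds (Metric.ball_mem_nhds a hr)] with b hb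
      obtain ⟨g, hg, hge⟩ := exists_log_div_of_dist_lt (K := K) (p := a) (q := b) (r := r)
        (fun z hz => by
          by_contra! hlt
          exact hball hlt hz) hb
      refine ⟨fun z => -g z, hg.neg, fun z hz => ?_⟩
      rw [Complex.exp_neg, hge z hz, inv_div]
    · rintro a b c - hb - ⟨g₁, h₁, e₁⟩ ⟨g₂, h₂, e₂⟩
      refine ⟨fun z => g₁ z + g₂ z, h₁.add h₂, fun z hz => ?_⟩
      have hbz : z - b ≠ 0 := sub_ne_zero.2 fun e => hΩK hb (e ▸ hz)
      rw [Complex.exp_add, e₁ z hz, e₂ z hz, div_mul_div_cancel₀ hbz]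
    · rintro a b - - ⟨g, hg, e⟩
      refine ⟨fun z => -g z, hg.neg, fun z hz => ?_⟩
      rw [Complex.exp_neg, e z hz, inv_div]
  obtain ⟨g, hg, e⟩ := hdiv
  have hq0 : q ≠ 0 := by
    rintro rfl
    rw [norm_zero] at hq
    linarith
  obtain ⟨g', hg', e'⟩ : ∃ g : ℂ → ℂ, ContinuousOn g K ∧
      ∀ z ∈ K, Complex.exp (g z) = 1 - z / q := by
    have hs : ∀ z ∈ K, 1 - z / q ∈ Complex.slitPlane := by
      intro z hz
      apply Complex.ball_one_subset_slitPlane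
      rw [Metric.mem_ball, dist_eq_norm, sub_sub_cancel_left, norm_neg, norm_div,
        div_lt_one (norm_pos_iff.2 hq0)]
      exact (hR z hz).trans hq
    exact ⟨fun z => Complex.log (1 - z / q), ContinuousOn.clog (by fun_prop) hs,
      fun z hz => Complex.exp_log (Complex.slitPlane_ne_zero (hs z hz))⟩
  refine ⟨fun z => g z + g' z + Complex.log (-q), (hg.add hg').add continuousOn_const,
    fun z hz => ?_⟩
  have hqz : z - q ≠ 0 := sub_ne_zero.2 fun h => hΩK hqΩ (h ▸ hz)
  rw [Complex.exp_add, Complex.exp_add, e z hz, e' z hz, Complex.exp_log (neg_ne_zero.2 hq0)]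
  field_simp
  ring

theorem HasLogs.preimage {K : Set ℂ} (hK : HasLogs K) {a : ℂ} (ha : a ≠ 0) (b : ℂ) :
    HasLogs ((fun z => a * z + b) ⁻¹' K) := by
  have hKc : (fun z => a * z + b) ⁻¹' K = (fun z => a⁻¹ * (z - b)) '' K := by
    ext z
    constructor
    · intro hz
      exact ⟨_, hz, by field_simp; ring⟩
    · rintro ⟨y, hy, rfl⟩
      show a * (a⁻¹ * (y - b)) + b ∈ K
      rwa [mul_inv_cancel_left₀ ha, sub_add_cancel]
  refine ⟨by rw [hKc]; exact hK.isCompact.image (by fun_prop), fun p hp => ?_⟩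
  obtain ⟨g, hg, e⟩ := hK.exists_log _ hp
  refine ⟨fun z => g (a * z + b) - Complex.log a, ?_, fun z hz => ?_⟩
  · have hm : MapsTo (fun z => a * z + b) ((fun z => a * z + b) ⁻¹' K) K := fun z hz => hz
    exact (hg.comp (by fun_prop) hm).sub continuousOn_const
  · rw [Complex.exp_sub, e _ hz, Complex.exp_log ha]
    field_simp
    ring

theorem re_mem_Ioo_of_segment_subset {K : Set ℂ} {p p' : ℝ} (hp : (p : ℂ) ∉ K) (hp' : (p' : ℂ) ∉ K)
    (h0 : p < 0) (h0' : 0 < p') {y : ℂ} (hy : y.im = 0) (hyK : segment ℝ 0 y ⊆ K) :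
    p < y.re ∧ y.re < p' := by
  have hmem : ∀ t ∈ segment ℝ 0 y.re, (t : ℂ) ∈ K := by
    rintro t ⟨a, b, ha, hb, hab, rfl⟩
    refine hyK ⟨a, b, ha, hb, hab, ?_⟩
    apply Complex.ext <;> simp [hy]
  constructor
  · by_contra! hlt
    refine hp (hmem p ?_)
    rw [segment_symm, segment_eq_Icc (by linarith)]
    exact ⟨hlt, h0.le⟩
  · by_contra! hlt
    refine hp' (hmem p' ?_)
    rw [segment_eq_Icc (by linarith)]
    exact ⟨h0'.le, hlt⟩

theorem exists_neg_notMem {K T : Set ℂ} (hK : IsCompact K) (hT : IsCompact T) (hTK : T ⊆ K)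
    (h0 : (0 : ℂ) ∈ K) (hsee : ∀ y ∈ T, y.im = 0 → ¬ segment ℝ 0 y ⊆ K) :
    ∃ p : ℝ, p < 0 ∧ (p : ℂ) ∉ K ∧ ∀ t : ℝ, p ≤ t → t ≤ 0 → (t : ℂ) ∉ T := by
  set S : Set ℝ := {t : ℝ | (t : ℂ) ∈ T} ∩ Iic 0 with hS
  obtain ⟨R, hR0, hR⟩ := hK.isBounded.exists_pos_norm_lt
  have hSc : IsCompact S := by
    refine Metric.isCompact_of_isClosed_isBounded
      ((hT.isClosed.preimage Complex.continuous_ofReal).inter isClosed_Iic) ?_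
    refine isBounded_iff_forall_norm_le.2 ⟨R, fun t ht => ?_⟩
    simpa using (hR _ (hTK ht.1)).le
  rcases S.eq_empty_or_nonempty with he | hne
  · refine ⟨-R, by linarith, fun h => ?_, fun t _ ht htT => ?_⟩
    · have := hR _ h
      simp [abs_of_pos hR0] at this
    · exact (he ▸ (⟨htT, ht⟩ : t ∈ S) : t ∈ (∅ : Set ℝ))
  · obtain ⟨t₀, ht₀, hmax⟩ := hSc.exists_isGreatest hne
    have := hsee _ ht₀.1 (by simp)
    obtain ⟨z, hz, hzK⟩ := not_subset.1 this
    obtain ⟨a, b, ha, hb, hab, rfl⟩ := hz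
    have hz : a • (0 : ℂ) + b • (t₀ : ℂ) = ((b * t₀ : ℝ) : ℂ) := by simp
    rw [hz] at hzK
    have ht0 : t₀ ≤ 0 := ht₀.2
    have h1 : t₀ ≤ b * t₀ := by nlinarith
    have h2 : b * t₀ ≤ 0 := by nlinarith
    refine ⟨b * t₀, lt_of_le_of_ne h2 fun e => hzK (by rw [e]; simpa using h0), hzK,
      fun t ht ht' htT => ?_⟩
    have h3 : t ≤ t₀ := hmax ⟨htT, ht'⟩
    have h4 : b * t₀ = t₀ := le_antisymm (ht.trans h3) h1
    exact hzK (by rw [h4]; exact hTK ht₀.1)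

theorem exists_pos_notMem {K T : Set ℂ} (hK : IsCompact K) (hT : IsCompact T) (hTK : T ⊆ K)
    (h0 : (0 : ℂ) ∈ K) (hsee : ∀ y ∈ T, y.im = 0 → ¬ segment ℝ 0 y ⊆ K) :
    ∃ p : ℝ, 0 < p ∧ (p : ℂ) ∉ K ∧ ∀ t : ℝ, 0 ≤ t → t ≤ p → (t : ℂ) ∉ T := by
  obtain ⟨p, hp0, hpK, hp⟩ := exists_neg_notMem (K := -K) (T := -T) hK.neg hT.neg
    (Set.neg_subset_neg.2 hTK) (by simpa using h0) (by
      intro y hy hyi hseg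
      refine hsee (-y) hy (by simpa using hyi) ?_
      rintro _ ⟨a, b, ha, hb, hab, rfl⟩
      have := hseg ⟨a, b, ha, hb, hab, rfl⟩
      simpa using this)
  refine ⟨-p, by linarith, fun h => hpK (by simpa using h), fun t h0t htp htT => ?_⟩
  exact hp (-t) (by linarith) (by linarith) (by simpa using htT)

theorem segment_crossing {u f y : ℂ} (hu : u.im ≠ 0) (hy : y ∈ segment ℝ u f) (hyi : y.im = 0)
    (hfy : f ≠ y) : f.im * u.im < 0 ∧ ∀ z ∈ segment ℝ u f, z.im = 0 → z = y := by
  obtain ⟨a, b, ha, hb, hab, rfl⟩ := hy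
  simp at hyi
  have hb0 : b ≠ 0 := by
    rintro rfl
    have : a = 1 := by linarith
    subst this
    simp at hyi
    exact hu hyi
  have hbpos : 0 < b := lt_of_le_of_ne hb hb0.symm
  have ha0 : a ≠ 0 := by
    rintro rfl
    have : b = 1 := by linarith
    subst this
    simp at hfy
  have hapos : 0 < a := lt_of_le_of_ne ha ha0.symm
  have husq : 0 < u.im ^ 2 := by positivity
  have hfu : b * (f.im * u.im) = - (a * u.im ^ 2) := by linear_combination u.im * hyi
  have hneg : f.im * u.im < 0 := by
    by_contra! hcon
    have := mul_nonneg hb hcon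
    have := mul_pos hapos husq
    linarith
  refine ⟨hneg, ?_⟩
  rintro z ⟨c, d, hc, hd, hcd, rfl⟩ hz
  simp at hz
  have ec : c = 1 - d := by linarith
  have ea : a = 1 - b := by linarith
  subst ec ea
  have hfuim : f.im - u.im ≠ 0 := by
    intro h
    have : f.im = u.im := by linarith
    rw [this] at hneg
    nlinarith
  have : d = b := by
    have h : (d - b) * (f.im - u.im) = 0 := by linear_combination hz - hyi
    rcases mul_eq_zero.1 h with h | h
    · linarith
    · exact absurd h hfuim
  rw [this]

theorem Complex.log_neg_of_im_neg {w : ℂ} (hw : w.im < 0) :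
    Complex.log (-w) = Complex.log w + Real.pi * Complex.I := by
  apply Complex.ext
  · simp [Complex.log_re]
  · simp [Complex.log_im, Complex.arg_neg_eq_arg_add_pi_of_im_neg hw]

theorem Complex.log_neg_of_im_pos {w : ℂ} (hw : 0 < w.im) :
    Complex.log (-w) = Complex.log w - Real.pi * Complex.I := by
  apply Complex.ext
  · simp [Complex.log_re]
  · simp [Complex.log_im, Complex.arg_neg_eq_arg_sub_pi_of_im_pos hw]

theorem im_sub_div_sub (p p' : ℝ) (z : ℂ) :
    ((z - p) / (z - p')).im = z.im * ((p - p') / Complex.normSq (z - p')) := by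
  rw [Complex.div_im]
  simp
  ring

/-- A closed curve made of two legs on opposite sides of the real axis and a connected set missing
the chord through the origin crosses that chord exactly once. -/
theorem HasLogs.leg_meets_chord_iff {K F : Set ℂ} (hK : HasLogs K) (hF : IsCompact F)
    (hFc : IsPreconnected F) (hFK : F ⊆ K) {u v f g : ℂ} (hf : f ∈ F) (hg : g ∈ F)
    (hu : 0 < u.im) (hv : v.im < 0) (h0 : (0 : ℂ) ∈ segment ℝ u v) (huv : segment ℝ u v ⊆ K)
    (huf : segment ℝ u f ⊆ K) (hvg : segment ℝ v g ⊆ K)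
    (hsee : ∀ y ∈ F, y.im = 0 → ¬ segment ℝ 0 y ⊆ K) :
    (∃ y ∈ segment ℝ u f, y.im = 0 ∧ segment ℝ 0 y ⊆ K) ↔
      ¬ ∃ y ∈ segment ℝ v g, y.im = 0 ∧ segment ℝ 0 y ⊆ K := by
  classical
  have segp : ∀ a b : ℂ, IsPreconnected (segment ℝ a b) := fun a b =>
    (convex_segment a b).isPreconnected
  set σ : Set ℂ := {y | y.im = 0 ∧ segment ℝ 0 y ⊆ K} with hσ
  set A : Set ℂ := if (∃ y ∈ segment ℝ u f, y ∈ σ) then ∅ else segment ℝ u f with hA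
  set B : Set ℂ := if (∃ y ∈ segment ℝ v g, y ∈ σ) then ∅ else segment ℝ v g with hB
  have hAc : IsCompact A := by
    rw [hA]; split_ifs
    · exact isCompact_empty
    · exact isCompact_segment _ _
  have hBc : IsCompact B := by
    rw [hB]; split_ifs
    · exact isCompact_empty
    · exact isCompact_segment _ _
  have hTK : F ∪ A ∪ B ⊆ K := by
    refine union_subset (union_subset hFK ?_) ?_
    · rw [hA]; split_ifs
      · exact empty_subset _
      · exact huf
    · rw [hB]; split_ifs
      · exact empty_subset _
      · exact hvg
  have hTsee : ∀ y ∈ F ∪ A ∪ B, y.im = 0 → ¬ segment ℝ 0 y ⊆ K := by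
    rintro y ((hy | hy) | hy) hyi hs
    · exact hsee y hy hyi hs
    · rw [hA] at hy
      split_ifs at hy with h
      · exact hy
      · exact h ⟨y, hy, hyi, hs⟩
    · rw [hB] at hy
      split_ifs at hy with h
      · exact hy
      · exact h ⟨y, hy, hyi, hs⟩
  have hTc : IsCompact (F ∪ A ∪ B) := (hF.union hAc).union hBc
  obtain ⟨p, hp0, hpK, hpT⟩ := exists_neg_notMem hK.isCompact hTc hTK (huv h0) hTsee
  obtain ⟨p', hp0', hpK', hpT'⟩ := exists_pos_notMem hK.isCompact hTc hTK (huv h0) hTsee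
  have hmiss : ∀ z ∈ F ∪ A ∪ B, z.im = 0 → ¬ (p ≤ z.re ∧ z.re ≤ p') := by
    rintro z hz hzi ⟨h1, h2⟩
    have hze : z = (z.re : ℂ) := Complex.ext (by simp) (by simpa using hzi)
    rcases le_total z.re 0 with h | h
    · exact hpT z.re h1 h (hze ▸ hz)
    · exact hpT' z.re h h2 (hze ▸ hz)
  obtain ⟨g₁, hg₁, e₁⟩ := hK.exists_log _ hpK
  obtain ⟨g₂, hg₂, e₂⟩ := hK.exists_log _ hpK'
  set h : ℂ → ℂ := fun z => (z - p) / (z - p') with hh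
  set G : ℂ → ℂ := fun z => g₁ z - g₂ z with hG
  have hGc : ContinuousOn G K := hg₁.sub hg₂
  have hGe : ∀ z ∈ K, Complex.exp (G z) = h z := fun z hz => by
    rw [hG, hh]
    simp only [Complex.exp_sub, e₁ z hz, e₂ z hz]
  have hne : ∀ z ∈ K, z - p' ≠ 0 := fun z hz => by
    rw [← e₂ z hz]; exact Complex.exp_ne_zero _
  have hhc : ContinuousOn h K :=
    (continuousOn_id.sub continuousOn_const).div (continuousOn_id.sub continuousOn_const) hne
  have him : ∀ z ∈ K, ∃ c < 0, (h z).im = z.im * c := fun z hz =>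
    ⟨_, div_neg_of_neg_of_pos (by linarith) (Complex.normSq_pos.2 (hne z hz)),
      im_sub_div_sub p p' z⟩
  have hreal : ∀ z : ℂ, z.im = 0 → h z = (((z.re - p) / (z.re - p') : ℝ) : ℂ) := fun z hz => by
    have hze : z = (z.re : ℂ) := Complex.ext (by simp) (by simpa using hz)
    rw [hh]
    simp only
    conv_lhs => rw [hze]
    push_cast
    rfl
  have hout : ∀ X ⊆ K, IsPreconnected X → (∀ z ∈ X, z.im = 0 → ¬ (p ≤ z.re ∧ z.re ≤ p')) →
      ∀ a ∈ X, ∀ b ∈ X, G a - Complex.log (h a) = G b - Complex.log (h b) := by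
    intro X hXK hX hXm a ha b hb
    have hs : ∀ z ∈ X, h z ∈ Complex.slitPlane := by
      intro z hz
      by_cases hzi : z.im = 0
      · rw [hreal z hzi, Complex.ofReal_mem_slitPlane]
        rcases not_and_or.1 (hXm z hz hzi) with hlt | hlt
        · push Not at hlt
          exact div_pos_of_neg_of_neg (by linarith) (by linarith)
        · push Not at hlt
          exact div_pos (by linarith) (by linarith)
      · obtain ⟨c, hc, e⟩ := him z (hXK hz)
        exact Or.inr (by rw [e]; exact mul_ne_zero hzi hc.ne)
    refine exp_lift_sub_eq hX (hGc.mono hXK) ((hhc.mono hXK).clog hs) (fun z hz => ?_) ha hb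
    rw [hGe z (hXK hz), Complex.exp_log (Complex.slitPlane_ne_zero (hs z hz))]
  have hin : ∀ X ⊆ K, IsPreconnected X → (∀ z ∈ X, z.im = 0 → p < z.re ∧ z.re < p') →
      ∀ a ∈ X, ∀ b ∈ X, G a - Complex.log (-h a) = G b - Complex.log (-h b) := by
    intro X hXK hX hXm a ha b hb
    have hs : ∀ z ∈ X, -h z ∈ Complex.slitPlane := by
      intro z hz
      by_cases hzi : z.im = 0
      · rw [hreal z hzi, ← Complex.ofReal_neg, Complex.ofReal_mem_slitPlane, neg_pos]
        obtain ⟨h1, h2⟩ := hXm z hz hzi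
        exact div_neg_of_pos_of_neg (by linarith) (by linarith)
      · obtain ⟨c, hc, e⟩ := him z (hXK hz)
        exact Or.inr (by rw [Complex.neg_im, e]; exact neg_ne_zero.2 (mul_ne_zero hzi hc.ne))
    have := exp_lift_sub_eq hX (g₁ := fun z => G z + Real.pi * Complex.I)
      ((hGc.mono hXK).add continuousOn_const) (((hhc.mono hXK).neg).clog hs) (fun z hz => ?_) ha hb
    · linear_combination this
    · rw [Complex.exp_add, Complex.exp_pi_mul_I, hGe z (hXK hz), mul_neg_one]
      exact (Complex.exp_log (Complex.slitPlane_ne_zero (hs z hz))).symm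
  have hpos : ∀ z ∈ K, 0 < z.im →
      G z - Complex.log (-h z) = G z - Complex.log (h z) - Real.pi * Complex.I := by
    intro z hz hzi
    obtain ⟨c, hc, e⟩ := him z hz
    rw [Complex.log_neg_of_im_neg (by rw [e]; exact mul_neg_of_pos_of_neg hzi hc)]
    ring
  have hneg : ∀ z ∈ K, z.im < 0 →
      G z - Complex.log (-h z) = G z - Complex.log (h z) + Real.pi * Complex.I := by
    intro z hz hzi
    obtain ⟨c, hc, e⟩ := him z hz
    rw [Complex.log_neg_of_im_pos (by rw [e]; exact mul_pos_of_neg_of_neg hzi hc)]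
    ring
  have hinσ : ∀ a b : ℂ, a.im ≠ 0 → segment ℝ a b ⊆ K → b ∈ F →
      ∀ y ∈ segment ℝ a b, y ∈ σ → b.im * a.im < 0 ∧
        G a - Complex.log (-h a) = G b - Complex.log (-h b) := by
    intro a b ha hab hb y hy hyσ
    have hby : b ≠ y := fun e => hsee b hb (e ▸ hyσ.1) (e ▸ hyσ.2)
    obtain ⟨h1, h2⟩ := segment_crossing ha hy hyσ.1 hby
    refine ⟨h1, hin _ hab (segp _ _) (fun z hz hzi => ?_) _ (left_mem_segment ℝ a b) _
      (right_mem_segment ℝ a b)⟩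
    rw [h2 z hz hzi]
    exact re_mem_Ioo_of_segment_subset hpK hpK' hp0 hp0' hyσ.1 hyσ.2
  have huK := huf (left_mem_segment ℝ u f)
  have hvK := hvg (left_mem_segment ℝ v g)
  have E1 : G u - Complex.log (-h u) = G v - Complex.log (-h v) := by
    by_cases hv0 : v = 0
    · simp [hv0] at hv
    have h2 := (segment_crossing hu.ne' h0 (by simp) hv0).2
    refine hin _ huv (segp _ _) (fun z hz hzi => ?_) _ (left_mem_segment ℝ u v) _
      (right_mem_segment ℝ u v)
    rw [h2 z hz hzi]
    exact ⟨by simpa using hp0, by simpa using hp0'⟩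
  rw [hpos u huK hu, hneg v hvK hv] at E1
  have E2 : G f - Complex.log (h f) = G g - Complex.log (h g) :=
    hout F hFK hFc (fun z hz => hmiss z (Or.inl (Or.inl hz))) f hf g hg
  have hpi : (Real.pi : ℂ) * Complex.I ≠ 0 :=
    mul_ne_zero (by exact_mod_cast Real.pi_ne_zero) Complex.I_ne_zero
  change (∃ y ∈ segment ℝ u f, y ∈ σ) ↔ ¬ ∃ y ∈ segment ℝ v g, y ∈ σ
  have U1 : (∃ y ∈ segment ℝ u f, y ∈ σ) →
      G f - Complex.log (h f) = G u - Complex.log (h u) - 2 * (Real.pi * Complex.I) := by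
    rintro ⟨y, hy, hyσ⟩
    obtain ⟨h1, h2⟩ := hinσ u f hu.ne' huf hf y hy hyσ
    have hfi : f.im < 0 := by nlinarith
    rw [hpos u huK hu, hneg f (hFK hf) hfi] at h2
    linear_combination -h2
  have V1 : (∃ y ∈ segment ℝ v g, y ∈ σ) →
      G g - Complex.log (h g) = G v - Complex.log (h v) + 2 * (Real.pi * Complex.I) := by
    rintro ⟨y, hy, hyσ⟩
    obtain ⟨h1, h2⟩ := hinσ v g hv.ne hvg hg y hy hyσ
    have hgi : 0 < g.im := by nlinarith
    rw [hneg v hvK hv, hpos g (hFK hg) hgi] at h2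
    linear_combination -h2
  have U2 : (¬ ∃ y ∈ segment ℝ u f, y ∈ σ) →
      G f - Complex.log (h f) = G u - Complex.log (h u) := by
    intro hno
    have hAe : A = segment ℝ u f := if_neg hno
    refine hout _ huf (segp _ _) (fun z hz => hmiss z (Or.inl (Or.inr (hAe ▸ hz)))) _
      (right_mem_segment ℝ u f) _ (left_mem_segment ℝ u f)
  have V2 : (¬ ∃ y ∈ segment ℝ v g, y ∈ σ) →
      G g - Complex.log (h g) = G v - Complex.log (h v) := by
    intro hno
    have hBe : B = segment ℝ v g := if_neg hno
    refine hout _ hvg (segp _ _) (fun z hz => hmiss z (Or.inr (hBe ▸ hz))) _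
      (right_mem_segment ℝ v g) _ (left_mem_segment ℝ v g)
  constructor
  · intro hU hV
    apply hpi
    linear_combination (U1 hU - V1 hV - E2 + E1) / 2
  · intro hV
    by_contra hU
    apply hpi
    linear_combination (U2 hU - V2 hV - E2 + E1) / (-2)

theorem exists_slope_forall_segment_ne {u f : ℂ} (hu : u.im = 0) (hu0 : u.re ≠ 0)
    (h0 : (0 : ℂ) ∉ segment ℝ u f) : ∃ s : ℝ, ∀ y ∈ segment ℝ u f, y.re ≠ y.im * s := by
  by_cases hf : f.im = 0
  · refine ⟨0, ?_⟩
    rintro y hy he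
    obtain ⟨a, b, ha, hb, hab, rfl⟩ := id hy
    refine h0 ?_
    convert hy
    apply Complex.ext
    · rw [he]; simp
    · simp [hu, hf]
  · refine ⟨(f.re - u.re) / f.im, ?_⟩
    rintro y ⟨a, b, ha, hb, hab, rfl⟩ he
    simp [hu] at he
    field_simp at he
    apply hu0
    linear_combination he - u.re * hab

theorem isClosed_slopes {C : Set ℂ} (hC : IsCompact C) :
    IsClosed {s : ℝ | ∃ y ∈ C, y.re = y.im * s} := by
  have : CompactSpace C := isCompact_iff_compactSpace.1 hC
  have h := isClosedMap_snd_of_compactSpace (X := C) (Y := ℝ) {q | (q.1 : ℂ).re = (q.1 : ℂ).im * q.2}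
    (isClosed_eq (by fun_prop) (by fun_prop))
  convert h using 1
  ext s
  simp

theorem HasLogs.exists_segment_subset_of_real {K F : Set ℂ} (hK : HasLogs K) (hF : IsCompact F)
    (hFc : IsPreconnected F) (hFK : F ⊆ K) {u v f g : ℂ} (hf : f ∈ F) (hg : g ∈ F)
    (hui : u.im = 0) (hvi : v.im = 0) (hu : u.re < 0) (hv : 0 < v.re)
    (huv : segment ℝ u v ⊆ K) (huf : segment ℝ u f ⊆ K) (hvg : segment ℝ v g ⊆ K) :
    ∃ y ∈ F, segment ℝ 0 y ⊆ K := by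
  by_contra! hsee
  have h0 : (0 : ℂ) ∈ segment ℝ u v := by
    have hd : 0 < v.re - u.re := by linarith
    refine ⟨v.re / (v.re - u.re), -u.re / (v.re - u.re), by positivity,
      div_nonneg (by linarith) hd.le, by field_simp; ring, ?_⟩
    apply Complex.ext
    · simp only [Complex.add_re, Complex.smul_re, smul_eq_mul, Complex.zero_re]
      field_simp
      ring
    · simp only [Complex.add_im, Complex.smul_im, smul_eq_mul, Complex.zero_im, hui, hvi]
      ring
  have hnot : ∀ a b : ℂ, b ∈ F → segment ℝ a b ⊆ K → (0 : ℂ) ∉ segment ℝ a b :=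
    fun a b hb hab h => hsee b hb
      (((convex_segment a b).segment_subset h (right_mem_segment ℝ a b)).trans hab)
  set V : Set ℂ := {y | segment ℝ 0 y ⊆ K} with hV
  have hVc : IsClosed V := by
    have : V = ⋂ t ∈ Icc (0 : ℝ) 1, (fun y : ℂ => (t : ℂ) * y) ⁻¹' K := by
      ext y
      simp only [hV, mem_ofPred_eq, segment_eq_image, mem_iInter, mem_preimage, image_subset_iff]
      simp [subset_def]
    rw [this]
    exact isClosed_biInter fun t _ => hK.isCompact.isClosed.preimage (by fun_prop)
  set A : Set ℝ := {s | ∃ y ∈ segment ℝ u f ∩ V, y.re = y.im * s} with hA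
  set B : Set ℝ := {s | ∃ y ∈ segment ℝ v g ∩ V, y.re = y.im * s} with hB
  have hAc : IsClosed A := isClosed_slopes ((isCompact_segment u f).inter_right hVc)
  have hBc : IsClosed B := isClosed_slopes ((isCompact_segment v g).inter_right hVc)
  have hAB : ∀ s, s ∈ A ↔ s ∉ B := by
    intro s
    set d : ℂ := ⟨s, 1⟩ with hd
    have hd0 : d ≠ 0 := fun h => by simpa [hd] using congrArg Complex.im h
    have hpre : ∀ a b : ℂ, ∀ z ∈ segment ℝ (d⁻¹ * a) (d⁻¹ * b), d * z ∈ segment ℝ a b := by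
      rintro a b z ⟨x, y, hx, hy, hxy, rfl⟩
      refine ⟨x, y, hx, hy, hxy, ?_⟩
      simp only [Complex.real_smul]
      field_simp
    have hpre' : ∀ a b : ℂ, ∀ z ∈ segment ℝ a b, d⁻¹ * z ∈ segment ℝ (d⁻¹ * a) (d⁻¹ * b) := by
      rintro a b z ⟨x, y, hx, hy, hxy, rfl⟩
      refine ⟨x, y, hx, hy, hxy, ?_⟩
      simp only [Complex.real_smul]
      ring
    set K' : Set ℂ := (fun z => d * z + 0) ⁻¹' K with hK'
    have hmem : ∀ z, z ∈ K' ↔ d * z ∈ K := fun z => by simp [hK']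
    have hseg : ∀ a b : ℂ, segment ℝ a b ⊆ K → segment ℝ (d⁻¹ * a) (d⁻¹ * b) ⊆ K' :=
      fun a b h z hz => (hmem z).2 (h (hpre a b z hz))
    have him : ∀ z : ℂ, (d⁻¹ * z).im = (z.im * s - z.re) / (s ^ 2 + 1) := by
      intro z
      rw [mul_comm, ← div_eq_mul_inv, Complex.div_im]
      simp [hd, Complex.normSq_apply]
      ring
    have hs1 : 0 < s ^ 2 + 1 := by positivity
    have him0 : ∀ z : ℂ, (d⁻¹ * z).im = 0 ↔ z.re = z.im * s := by
      intro z
      rw [him, div_eq_zero_iff]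
      constructor
      · rintro (h | h) <;> linarith
      · intro h
        left
        linarith
    have hV' : ∀ z : ℂ, segment ℝ 0 z ⊆ K' ↔ d * z ∈ V := by
      intro z
      constructor
      · intro h w hw
        have := h (by simpa [inv_mul_cancel_left₀ hd0] using hpre' 0 (d * z) w hw)
        rwa [hmem, mul_inv_cancel_left₀ hd0] at this
      · intro h
        simpa [inv_mul_cancel_left₀ hd0] using hseg 0 (d * z) h
    have hset : ∀ a b : ℂ, (∃ y ∈ segment ℝ (d⁻¹ * a) (d⁻¹ * b), y.im = 0 ∧ segment ℝ 0 y ⊆ K') ↔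
        ∃ y ∈ segment ℝ a b ∩ V, y.re = y.im * s := by
      intro a b
      constructor
      · rintro ⟨y, hy, hyi, hyV⟩
        refine ⟨d * y, ⟨hpre a b y hy, (hV' y).1 hyV⟩, (him0 _).1 ?_⟩
        rwa [inv_mul_cancel_left₀ hd0]
      · rintro ⟨y, ⟨hy, hyV⟩, hyi⟩
        refine ⟨d⁻¹ * y, hpre' a b y hy, (him0 _).2 hyi, (hV' _).2 ?_⟩
        rwa [mul_inv_cancel_left₀ hd0]
    have := (hK.preimage hd0 0).leg_meets_chord_iff (F := (fun z => d⁻¹ * z) '' F)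
      (hF.image (by fun_prop)) (hFc.image _ (by fun_prop))
      (by
        rintro _ ⟨z, hz, rfl⟩
        show d * (d⁻¹ * z) + 0 ∈ K
        rw [mul_inv_cancel_left₀ hd0, add_zero]
        exact hFK hz)
      (u := d⁻¹ * u) (v := d⁻¹ * v) (mem_image_of_mem _ hf) (mem_image_of_mem _ hg)
      (by rw [him, hui]; exact div_pos (by linarith) hs1)
      (by rw [him, hvi]; exact div_neg_of_neg_of_pos (by linarith) hs1)
      (by simpa using hpre' u v 0 h0) (hseg u v huv) (hseg u f huf) (hseg v g hvg)
      (by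
        rintro _ ⟨z, hz, rfl⟩ - h
        refine hsee z hz ?_
        have := (hV' _).1 h
        rwa [mul_inv_cancel_left₀ hd0] at this)
    rw [← hK'] at this
    rw [hset u f, hset v g] at this
    exact this
  have hAclopen : IsClopen A := by
    refine ⟨hAc, ?_⟩
    have : A = Bᶜ := by ext s; exact hAB s
    rw [this]
    exact hBc.isOpen_compl
  rcases isClopen_iff.1 hAclopen with h | h
  · obtain ⟨s, hs⟩ := exists_slope_forall_segment_ne hvi hv.ne' (hnot v g hg hvg)
    have : s ∈ B := by
      by_contra hsB
      exact (h ▸ (hAB s).2 hsB : s ∈ (∅ : Set ℝ))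
    obtain ⟨y, hy, he⟩ := this
    exact hs y hy.1 he
  · obtain ⟨s, hs⟩ := exists_slope_forall_segment_ne hui hu.ne (hnot u f hf huf)
    obtain ⟨y, hy, he⟩ : s ∈ A := h ▸ mem_univ s
    exact hs y hy.1 he

/-- In a plane set with logarithms, the set of points seen by a connected set is relatively
convex. -/
theorem HasLogs.exists_segment_subset {K F : Set ℂ} (hK : HasLogs K) (hF : IsCompact F)
    (hFc : IsPreconnected F) (hFK : F ⊆ K) {u v f g x : ℂ} (hf : f ∈ F) (hg : g ∈ F)
    (huv : segment ℝ u v ⊆ K) (huf : segment ℝ u f ⊆ K) (hvg : segment ℝ v g ⊆ K)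
    (hx : x ∈ segment ℝ u v) : ∃ y ∈ F, segment ℝ x y ⊆ K := by
  by_cases hxu : x = u
  · exact ⟨f, hf, hxu ▸ huf⟩
  by_cases hxv : x = v
  · exact ⟨g, hg, hxv ▸ hvg⟩
  obtain ⟨a, b, ha, hb, hab, hxe⟩ := hx
  have ha0 : a ≠ 0 := by
    rintro rfl
    simp at hab
    subst hab
    simp at hxe
    exact hxv hxe.symm
  have hb0 : b ≠ 0 := by
    rintro rfl
    simp at hab
    subst hab
    simp at hxe
    exact hxu hxe.symm
  have hd : v - x ≠ 0 := sub_ne_zero.2 (Ne.symm hxv)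
  set d := v - x with hdd
  have hac : (a : ℂ) ≠ 0 := by exact_mod_cast ha0
  have habc : (a : ℂ) + b = 1 := by exact_mod_cast hab
  simp only [Complex.real_smul] at hxe
  have hu' : d⁻¹ * (u - x) = ((-(b / a) : ℝ) : ℂ) := by
    have : a * (u - x) = - (b * d) := by
      rw [hdd]
      linear_combination hxe - x * habc
    push_cast
    field_simp
    linear_combination this
  have hv' : d⁻¹ * (v - x) = 1 := inv_mul_cancel₀ hd
  set K' : Set ℂ := (fun z => d * z + x) ⁻¹' K with hK'
  have hseg : ∀ p q : ℂ, segment ℝ p q ⊆ K →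
      segment ℝ (d⁻¹ * (p - x)) (d⁻¹ * (q - x)) ⊆ K' := by
    rintro p q h z ⟨s, t, hs, ht, hst, rfl⟩
    refine h ⟨s, t, hs, ht, hst, ?_⟩
    have hstc : (s : ℂ) + t = 1 := by exact_mod_cast hst
    simp only [Complex.real_smul]
    field_simp
    linear_combination x * hstc
  have hapos : 0 < a := lt_of_le_of_ne ha ha0.symm
  have hbpos : 0 < b := lt_of_le_of_ne hb hb0.symm
  obtain ⟨_, ⟨y, hy, rfl⟩, hyK⟩ := (hK.preimage hd x).exists_segment_subset_of_real
    (F := (fun z => d⁻¹ * (z - x)) '' F)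
    (hF.image (by fun_prop)) (hFc.image _ (by fun_prop))
    (by
      rintro _ ⟨z, hz, rfl⟩
      show d * (d⁻¹ * (z - x)) + x ∈ K
      rw [mul_inv_cancel_left₀ hd, sub_add_cancel]
      exact hFK hz)
    (mem_image_of_mem _ hf) (mem_image_of_mem _ hg)
    (by rw [hu', Complex.ofReal_im]) (by rw [hv', Complex.one_im])
    (by rw [hu', Complex.ofReal_re, neg_lt_zero]; positivity)
    (by rw [hv', Complex.one_re]; exact one_pos)
    (hseg u v huv) (hseg u f huf) (hseg v g hvg)
  refine ⟨y, hy, ?_⟩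
  rintro z ⟨s, t, hs, ht, hst, rfl⟩
  have := hyK ⟨s, t, hs, ht, hst, rfl⟩
  have hstc : (s : ℂ) + t = 1 := by exact_mod_cast hst
  have h2 : d * (s • (0 : ℂ) + t • (d⁻¹ * (y - x))) + x ∈ K := this
  convert h2 using 1
  simp only [Complex.real_smul]
  field_simp
  linear_combination x * hstc

namespace SimplePolygon

variable (P : SimplePolygon)

theorem isCompact_boundary : IsCompact P.boundary :=
  (Finset.range P.n).finite_toSet.isCompact_biUnion fun _ _ => isCompact_segment _ _

theorem boundary_subset_region : P.boundary ⊆ P.region := subset_union_left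

theorem segment_vertex_subset_region {i : ℕ} (hi : i < P.n) :
    segment ℝ (P.vertex i) (P.vertex (i + 1)) ⊆ P.region := fun _ hx =>
  P.boundary_subset_region (mem_biUnion (Finset.mem_coe.2 (Finset.mem_range.2 hi)) hx)

theorem vertex_mem_region {i : ℕ} (hi : i < P.n) : P.vertex i ∈ P.region :=
  P.segment_vertex_subset_region hi (left_mem_segment ℝ _ _)

theorem mem_region_of_connectedComponentIn {x y : Plane} (hx : x ∈ P.region)
    (hy : y ∈ connectedComponentIn P.boundaryᶜ x) : y ∈ P.region := by
  rcases hx with hx | hx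
  · rw [connectedComponentIn_eq_empty (by simpa using hx)] at hy
    exact hy.elim
  · refine Or.inr ⟨connectedComponentIn_subset _ _ hy, ?_⟩
    rw [← connectedComponentIn_eq hy]
    exact hx.2

theorem exists_unbounded_of_notMem_region {x : Plane} (hx : x ∉ P.region) :
    ∃ Ω : Set Plane, IsOpen Ω ∧ x ∈ Ω ∧ Ω ⊆ P.regionᶜ ∧ IsPreconnected Ω ∧
      ¬ Bornology.IsBounded Ω := by
  have hxb : x ∈ P.boundaryᶜ := fun h => hx (P.boundary_subset_region h)
  have hopen : IsOpen P.boundaryᶜ := P.isCompact_boundary.isClosed.isOpen_compl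
  refine ⟨connectedComponentIn P.boundaryᶜ x, hopen.connectedComponentIn,
    mem_connectedComponentIn hxb, fun y hy hyr => hx ?_, isPreconnected_connectedComponentIn,
    fun hb => hx (Or.inr ⟨hxb, hb⟩)⟩
  refine P.mem_region_of_connectedComponentIn hyr ?_
  rw [← connectedComponentIn_eq hy]
  exact mem_connectedComponentIn hxb

theorem isClosed_region : IsClosed P.region := by
  rw [← isOpen_compl_iff, isOpen_iff_forall_mem_open]
  intro x hx
  obtain ⟨Ω, ho, hxΩ, hΩ, -⟩ := P.exists_unbounded_of_notMem_region hx
  exact ⟨Ω, hΩ, ho, hxΩ⟩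

theorem not_isBounded_ray (x : Plane) {d : Plane} (hd : d ≠ 0) :
    ¬ Bornology.IsBounded ((fun t : ℝ => x + t • d) '' Ici 0) := by
  intro h
  obtain ⟨R, hR⟩ := isBounded_iff_forall_norm_le.1 h
  have hd' : 0 < ‖d‖ := norm_pos_iff.2 hd
  have hR0 : 0 ≤ R := (norm_nonneg _).trans (hR _ (mem_image_of_mem _ (mem_Ici.2 le_rfl)))
  set t := (R + ‖x‖ + 1) / ‖d‖ with ht
  have ht0 : 0 ≤ t := by positivity
  have h1 := hR _ (mem_image_of_mem (fun t : ℝ => x + t • d) (mem_Ici.2 ht0))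
  have h2 : ‖t • d‖ = R + ‖x‖ + 1 := by
    rw [norm_smul, Real.norm_of_nonneg ht0, ht, div_mul_cancel₀ _ hd'.ne']
  have h3 : ‖t • d‖ ≤ ‖x + t • d‖ + ‖x‖ := by
    simpa [add_comm] using norm_sub_le (x + t • d) x
  linarith

theorem exists_mem_boundary_ray {x d : Plane} (hx : x ∈ P.region) (hd : d ≠ 0) :
    ∃ t : ℝ, 0 ≤ t ∧ x + t • d ∈ P.boundary ∧ segment ℝ x (x + t • d) ⊆ P.region := by
  by_cases hxb : x ∈ P.boundary
  · refine ⟨0, le_rfl, by simpa using hxb, ?_⟩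
    simpa using hx
  have hbdd : Bornology.IsBounded (connectedComponentIn P.boundaryᶜ x) := by
    rcases hx with h | h
    · exact absurd h hxb
    · exact h.2
  have hcont : Continuous fun t : ℝ => x + t • d := by fun_prop
  have hpre : ∀ S : Set ℝ, IsPreconnected S → 0 ∈ S →
      (∀ t ∈ S, x + t • d ∉ P.boundary) →
      (fun t : ℝ => x + t • d) '' S ⊆ connectedComponentIn P.boundaryᶜ x := by
    intro S hS h0 hSb
    refine (hS.image _ hcont.continuousOn).subset_connectedComponentIn ⟨0, h0, by simp⟩ ?_
    rintro _ ⟨t, ht, rfl⟩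
    exact hSb t ht
  set T : Set ℝ := Ici 0 ∩ (fun t : ℝ => x + t • d) ⁻¹' P.boundary with hT
  have hTc : IsClosed T := isClosed_Ici.inter (P.isCompact_boundary.isClosed.preimage hcont)
  have hTne : T.Nonempty := by
    by_contra hne
    refine not_isBounded_ray x hd (hbdd.subset (hpre _ isPreconnected_Ici (mem_Ici.2 le_rfl) ?_))
    intro t ht htb
    exact hne ⟨t, ht, htb⟩
  have hTb : BddBelow T := ⟨0, fun t ht => ht.1⟩
  have hmem := hTc.csInf_mem hTne hTb
  set t₀ := sInf T
  refine ⟨t₀, hmem.1, hmem.2, ?_⟩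
  have hin : ∀ t, 0 ≤ t → t ≤ t₀ → x + t • d ∈ P.region := by
    intro t h0 ht
    rcases ht.eq_or_lt with rfl | hlt
    · exact P.boundary_subset_region hmem.2
    · refine P.mem_region_of_connectedComponentIn hx (hpre (Icc 0 t) isPreconnected_Icc
        ⟨le_rfl, h0⟩ ?_ (mem_image_of_mem _ ⟨h0, le_rfl⟩))
      intro s hs hsb
      have := csInf_le hTb ⟨hs.1, hsb⟩
      linarith [hs.2]
  rw [segment_eq_image']
  rintro _ ⟨s, hs, rfl⟩
  have := hin (s * t₀) (mul_nonneg hs.1 hmem.1) (mul_le_of_le_one_left hmem.1 hs.2)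
  simpa [smul_smul] using this

theorem isBounded_region : Bornology.IsBounded P.region := by
  obtain ⟨R, hR0, hR⟩ := P.isCompact_boundary.isBounded.exists_pos_norm_lt
  refine isBounded_iff_forall_norm_le.2 ⟨R, fun x hx => ?_⟩
  by_contra! hlt
  have hx0 : x ≠ 0 := by
    rintro rfl
    rw [norm_zero] at hlt
    linarith
  obtain ⟨t, ht, hb, -⟩ := P.exists_mem_boundary_ray hx hx0
  have h1 := hR _ hb
  have h2 : x + t • x = (1 + t) • x := by rw [add_smul, one_smul]
  rw [h2, norm_smul, Real.norm_of_nonneg (by linarith)] at h1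
  nlinarith [norm_nonneg x]

theorem isCompact_region : IsCompact P.region :=
  Metric.isCompact_of_isClosed_isBounded P.isClosed_region P.isBounded_region

/-- The identification of the plane with the complex numbers. -/
def toComplex : Plane ≃ₗᵢ[ℝ] ℂ := Complex.orthonormalBasisOneI.repr.symm

theorem toComplex_segment (a b : Plane) :
    toComplex '' segment ℝ a b = segment ℝ (toComplex a) (toComplex b) :=
  image_segment ℝ toComplex.toLinearEquiv.toLinearMap.toAffineMap a b

theorem hasLogs_region : HasLogs (toComplex '' P.region) := by
  refine HasLogs.of_unbounded (P.isCompact_region.image toComplex.continuous) fun p hp => ?_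
  obtain ⟨x, rfl⟩ := toComplex.surjective p
  have hx : x ∉ P.region := fun h => hp (mem_image_of_mem _ h)
  obtain ⟨Ω, -, hxΩ, hΩ, hc, hub⟩ := P.exists_unbounded_of_notMem_region hx
  refine ⟨toComplex '' Ω, mem_image_of_mem _ hxΩ, ?_,
    hc.image _ toComplex.continuous.continuousOn, fun hb => hub ?_⟩
  · rw [← image_compl_eq toComplex.bijective]
    exact image_mono hΩ
  · obtain ⟨R, hR⟩ := isBounded_iff_forall_norm_le.1 hb
    refine isBounded_iff_forall_norm_le.2 ⟨R, fun y hy => ?_⟩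
    simpa using hR _ (mem_image_of_mem _ hy)

/-- `F` sees `x` if some point of `F` is joined to `x` by a segment in the polygon. -/
def Sees (F : Set Plane) (x : Plane) : Prop :=
  ∃ y ∈ F, segment ℝ x y ⊆ P.region

variable {P}

theorem Sees.of_mem_segment {F : Set Plane} (hF : IsCompact F) (hFc : IsPreconnected F)
    (hFK : F ⊆ P.region) {u v x : Plane} (hu : P.Sees F u) (hv : P.Sees F v)
    (huv : segment ℝ u v ⊆ P.region) (hx : x ∈ segment ℝ u v) : P.Sees F x := by
  obtain ⟨f, hf, huf⟩ := hu
  obtain ⟨g, hg, hvg⟩ := hv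
  have hseg : ∀ a b : Plane, segment ℝ a b ⊆ P.region →
      segment ℝ (toComplex a) (toComplex b) ⊆ toComplex '' P.region := fun a b h => by
    rw [← toComplex_segment]
    exact image_mono h
  obtain ⟨_, ⟨y, hy, rfl⟩, hxy⟩ := P.hasLogs_region.exists_segment_subset
    (hF.image toComplex.continuous) (hFc.image _ toComplex.continuous.continuousOn)
    (image_mono hFK) (mem_image_of_mem _ hf) (mem_image_of_mem _ hg)
    (hseg _ _ huv) (hseg _ _ huf) (hseg _ _ hvg)
    (by rw [← toComplex_segment]; exact mem_image_of_mem _ hx)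
  refine ⟨y, hy, ?_⟩
  rw [← toComplex_segment] at hxy
  exact (image_subset_image_iff toComplex.injective).1 hxy

/-- A connected set that sees every vertex sees the whole polygon. -/
theorem Sees.of_forall_vertex {F : Set Plane} (hF : IsCompact F) (hFc : IsPreconnected F)
    (hFK : F ⊆ P.region) (h : ∀ i < P.n, P.Sees F (P.vertex i)) {x : Plane}
    (hx : x ∈ P.region) : P.Sees F x := by
  have hsucc : ∀ i < P.n, P.Sees F (P.vertex (i + 1)) := by
    intro i hi
    rcases (Nat.succ_le_of_lt hi).eq_or_lt with he | hlt
    · have h0 := P.periodic 0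
      rw [zero_add] at h0
      rw [show i + 1 = P.n from he, h0]
      exact h 0 (by have := P.three_le; omega)
    · exact h _ hlt
  have hbd : ∀ z ∈ P.boundary, P.Sees F z := by
    intro z hz
    obtain ⟨i, hi, hzi⟩ := mem_iUnion₂.1 hz
    have hi' : i < P.n := Finset.mem_range.1 hi
    exact Sees.of_mem_segment hF hFc hFK (h i hi') (hsucc i hi')
      (P.segment_vertex_subset_region hi') hzi
  set d : Plane := EuclideanSpace.single 0 1 with hd
  have hd0 : d ≠ 0 := by
    intro h0
    have := congrArg norm h0
    simp [hd] at this
  obtain ⟨s, hs, hsb, hsK⟩ := P.exists_mem_boundary_ray hx hd0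
  obtain ⟨t, ht, htb, htK⟩ := P.exists_mem_boundary_ray hx (neg_ne_zero.2 hd0)
  have hmem : x ∈ segment ℝ (x + t • -d) (x + s • d) := by
    rcases (add_nonneg ht hs).eq_or_lt with h0 | h0
    · have hs0 : s = 0 := by linarith
      subst hs0
      simpa using right_mem_segment ℝ (x + t • -d) x
    · refine ⟨s / (t + s), t / (t + s), by positivity, by positivity, by field_simp; ring, ?_⟩
      have e : s / (t + s) + t / (t + s) = 1 := by field_simp; ring
      rw [smul_add, smul_add, smul_smul, smul_smul, smul_neg]
      calc _ = (s / (t + s) + t / (t + s)) • x + (t / (t + s) * s - s / (t + s) * t) • d := by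
            module
        _ = x := by rw [e, show t / (t + s) * s - s / (t + s) * t = 0 by ring]; simp
  refine Sees.of_mem_segment hF hFc hFK (hbd _ htb) (hbd _ hsb) ?_ hmem
  intro z hz
  have hxK : segment ℝ (x + t • -d) x ⊆ P.region := by rwa [segment_symm]
  have hline : x ∈ range (AffineMap.lineMap (k := ℝ) (x + t • -d) (x + s • d)) := by
    rw [segment_eq_image_lineMap] at hmem
    exact image_subset_range _ _ hmem
  rw [← insert_endpoints_openSegment] at hz
  rcases hz with rfl | rfl | hz
  · exact P.boundary_subset_region htb
  · exact P.boundary_subset_region hsb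
  rcases openSegment_subset_union (𝕜 := ℝ) _ _ hline hz with rfl | hz | hz
  · exact hx
  · exact hxK (openSegment_subset_segment ℝ _ _ hz)
  · exact hsK (openSegment_subset_segment ℝ _ _ hz)

variable (P)

theorem joinedIn_vertex_zero {i : ℕ} (hi : i < P.n) :
    JoinedIn P.region (P.vertex 0) (P.vertex i) := by
  induction i with
  | zero => exact JoinedIn.refl (P.vertex_mem_region hi)
  | succ k ih =>
    have hk : k < P.n := by omega
    exact (ih hk).trans (JoinedIn.of_segment_subset (P.segment_vertex_subset_region hk))

theorem joinedIn_region {x y : Plane} (hx : x ∈ P.region) (hy : y ∈ P.region) :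
    JoinedIn P.region x y := by
  have hb : ∀ z ∈ P.boundary, JoinedIn P.region (P.vertex 0) z := by
    intro z hz
    obtain ⟨i, hi, hzi⟩ := mem_iUnion₂.1 hz
    have hi' : i < P.n := Finset.mem_range.1 hi
    exact (P.joinedIn_vertex_zero hi').trans (JoinedIn.of_segment_subset
      (((convex_segment _ _).segment_subset (left_mem_segment ℝ _ _) hzi).trans
        (P.segment_vertex_subset_region hi')))
  have h : ∀ z ∈ P.region, JoinedIn P.region (P.vertex 0) z := by
    intro z hz
    have hd : (EuclideanSpace.single 0 1 : Plane) ≠ 0 := by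
      intro h0
      simpa using congrArg norm h0
    obtain ⟨t, -, htb, htK⟩ := P.exists_mem_boundary_ray hz hd
    exact (hb _ htb).trans (JoinedIn.of_segment_subset htK).symm
  exact (h x hx).symm.trans (h y hy)

variable {P}

theorem mem_Vis_iff {x y : Plane} : y ∈ P.Vis x ↔ segment ℝ x y ⊆ P.region :=
  ⟨fun h => h.2, fun h => ⟨h (right_mem_segment ℝ x y), h⟩⟩

theorem mem_Vis_self {x : Plane} (hx : x ∈ P.region) : x ∈ P.Vis x :=
  mem_Vis_iff.2 (by simpa using hx)

theorem Vis_subset_region (x : Plane) : P.Vis x ⊆ P.region := fun _ h => h.1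

theorem isCompact_Vis (x : Plane) : IsCompact (P.Vis x) := by
  have : P.Vis x = ⋂ t ∈ Icc (0 : ℝ) 1, (fun y => x + t • (y - x)) ⁻¹' P.region := by
    ext y
    simp only [mem_Vis_iff, segment_eq_image', mem_iInter, mem_preimage, subset_def,
      forall_mem_image]
  refine P.isCompact_region.of_isClosed_subset ?_ (Vis_subset_region x)
  rw [this]
  exact isClosed_biInter fun t _ => P.isClosed_region.preimage (by fun_prop)

theorem segment_subset_Vis {x y : Plane} (hy : y ∈ P.Vis x) : segment ℝ x y ⊆ P.Vis x :=
  fun _ hz => mem_Vis_iff.2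
    (((convex_segment x y).segment_subset (left_mem_segment ℝ x y) hz).trans hy.2)

theorem isPreconnected_Vis (x : Plane) : IsPreconnected (P.Vis x) :=
  isPreconnected_of_forall x fun y hy => ⟨segment ℝ x y, segment_subset_Vis hy,
    left_mem_segment ℝ x y, right_mem_segment ℝ x y, (convex_segment x y).isPreconnected⟩

variable (P) in
/-- The points `x` and `y` lie in a common compact connected set that is invisible from `w`. -/
def JoinedOffVis (w x y : Plane) : Prop :=
  ∃ C ⊆ P.region \ P.Vis w, IsCompact C ∧ IsPreconnected C ∧ x ∈ C ∧ y ∈ C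

theorem JoinedOffVis.trans {w x y z : Plane} (hxy : P.JoinedOffVis w x y)
    (hyz : P.JoinedOffVis w y z) : P.JoinedOffVis w x z := by
  obtain ⟨C, hC, hCc, hCp, hx, hy⟩ := hxy
  obtain ⟨D, hD, hDc, hDp, hy', hz⟩ := hyz
  exact ⟨C ∪ D, union_subset hC hD, hCc.union hDc, hCp.union y hy hy' hDp, Or.inl hx, Or.inr hz⟩

theorem joinedOffVis_of_disjoint {w z y : Plane} (hz : z ∈ P.region)
    (hd : Disjoint (P.Vis w) (P.Vis z)) (hy : y ∈ P.Vis z) : P.JoinedOffVis w y z :=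
  ⟨P.Vis z, fun _ hv => ⟨hv.1, fun hv' => disjoint_left.1 hd hv' hv⟩, isCompact_Vis z,
    isPreconnected_Vis z, hy, mem_Vis_self hz⟩

/-- Everything joined to `q` off the visibility region of `w` stays joined to `q` off the
visibility region of a further witness `z` that is not joined to `q` itself. -/
theorem JoinedOffVis.change {w q z x : Plane} (hz : z ∈ P.region)
    (hd : Disjoint (P.Vis w) (P.Vis z)) (hqz : ¬ P.JoinedOffVis w q z)
    (hqx : P.JoinedOffVis w q x) : P.JoinedOffVis z q x := by
  obtain ⟨C, hC, hCc, hCp, hq, hx⟩ := hqx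
  refine ⟨C, fun y hy => ⟨(hC hy).1, fun hyz => hqz ?_⟩, hCc, hCp, hq, hx⟩
  exact JoinedOffVis.trans ⟨C, hC, hCc, hCp, hq, hy⟩ (joinedOffVis_of_disjoint hz hd hyz)

theorem joinedOffVis_of_not_joinedOffVis {w q z : Plane} (hw : w ∈ P.region) (hq : q ∈ P.region)
    (hz : z ∈ P.region) (hd : Disjoint (P.Vis w) (P.Vis z)) (hqz : ¬ P.JoinedOffVis w q z) :
    P.JoinedOffVis z q w := by
  obtain ⟨γ, hγ⟩ := P.joinedIn_region hq hw
  set T : Set (Set.Icc (0 : ℝ) 1) := γ ⁻¹' P.Vis w with hT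
  have hTc : IsCompact T := ((isCompact_Vis w).isClosed.preimage γ.continuous).isCompact
  obtain ⟨t, ht, hmin⟩ := hTc.exists_isLeast ⟨1, by simpa [hT] using mem_Vis_self hw⟩
  have hpc : ∀ s : Set.Icc (0 : ℝ) 1, IsPreconnected (γ '' Iic s) := fun s =>
    (isPreconnected_Iic).image _ γ.continuous.continuousOn
  have hcc : ∀ s : Set.Icc (0 : ℝ) 1, IsCompact (γ '' Iic s) := fun s =>
    isClosed_Iic.isCompact.image γ.continuous
  have h0 : ∀ s : Set.Icc (0 : ℝ) 1, q ∈ γ '' Iic s := fun s => ⟨0, s.2.1, γ.source⟩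
  have hoff : P.JoinedOffVis z q (γ t) := by
    refine ⟨γ '' Iic t, ?_, hcc t, hpc t, h0 t, mem_image_of_mem _ (mem_Iic.2 le_rfl)⟩
    rintro _ ⟨s, hs, rfl⟩
    refine ⟨hγ s, fun hsz => ?_⟩
    rcases (mem_Iic.1 hs).eq_or_lt with rfl | hlt
    · exact disjoint_left.1 hd ht hsz
    · refine hqz (JoinedOffVis.trans ⟨γ '' Iic s, ?_, hcc s, hpc s, h0 s,
        mem_image_of_mem _ (mem_Iic.2 le_rfl)⟩ (joinedOffVis_of_disjoint hz hd hsz))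
      rintro _ ⟨r, hr, rfl⟩
      exact ⟨hγ r, fun hrw => absurd (hmin hrw) (not_le.2 ((mem_Iic.1 hr).trans_lt hlt))⟩
  exact hoff.trans (joinedOffVis_of_disjoint hw hd.symm ht)

theorem IsWitnessSet.disjoint {W : Set Plane} (hW : P.IsWitnessSet W) {x y : Plane} (hx : x ∈ W)
    (hy : y ∈ W) (hxy : x ≠ y) : Disjoint (P.Vis x) (P.Vis y) :=
  disjoint_iff_inter_eq_empty.2 (hW.2.2 x hx y hy hxy)

/-- Some witness does not separate the other witnesses from each other. -/
theorem IsWitnessSet.exists_forall_joinedOffVis {W : Set Plane} (hW : P.IsWitnessSet W)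
    (hW2 : W.Nontrivial) :
    ∃ w ∈ W, ∃ q, ∀ z ∈ W, z ≠ w → P.JoinedOffVis w q z := by
  set N : Plane × Plane → Set Plane := fun p => {z ∈ W | z ≠ p.1 ∧ P.JoinedOffVis p.1 p.2 z}
    with hN
  obtain ⟨a, ha, b, hb, hab⟩ := hW2
  obtain ⟨⟨w, q⟩, ⟨hw, hq, hwq⟩, hmax⟩ := Set.exists_max_image W.offDiag (fun p => (N p).ncard)
    hW.1.offDiag ⟨(a, b), ha, hb, hab⟩
  simp only at hw hq hwq
  refine ⟨w, hw, q, fun z hz hzw => ?_⟩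
  by_contra hqz
  have hd := hW.disjoint hw hz hzw.symm
  have hzr := hW.2.1 hz
  have hqw := joinedOffVis_of_not_joinedOffVis (hW.2.1 hw) (hW.2.1 hq) hzr hd hqz
  have hqq : P.JoinedOffVis w q q :=
    joinedOffVis_of_disjoint (hW.2.1 hq) (hW.disjoint hw hq hwq) (mem_Vis_self (hW.2.1 hq))
  have hqne : q ≠ z := fun e => hqz (e ▸ hqq)
  have hss : N (w, q) ⊂ N (z, q) := by
    refine (ssubset_iff_of_subset ?_).2 ⟨w, ⟨hw, hzw.symm, hqw⟩, fun h => h.2.1 rfl⟩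
    rintro x ⟨hx, hxw, hqx⟩
    refine ⟨hx, ?_, hqx.change hzr hd hqz⟩
    rintro rfl
    exact hqz hqx
  have hlt := ncard_lt_ncard hss (hW.1.subset fun x hx => hx.1)
  exact absurd (hmax (z, q) ⟨hz, hq, hqne.symm⟩) (not_le.2 hlt)

/-- If the witnesses other than `w` are joined off the visibility region of `w`, then some vertex
can replace `w`. -/
theorem IsWitnessSet.exists_vertex_disjoint {W : Set Plane} (hW : P.IsWitnessSet W) {w q : Plane}
    (hw : w ∈ W) (hq : ∀ z ∈ W, z ≠ w → P.JoinedOffVis w q z) :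
    ∃ i < P.n, ∀ z ∈ W, z ≠ w → Disjoint (P.Vis (P.vertex i)) (P.Vis z) := by
  choose! C hCs hCc hCp hqC hzC using hq
  set F : Set Plane := ⋃ z ∈ W \ {w}, (C z ∪ P.Vis z) with hF
  have hFs : F ⊆ P.region \ P.Vis w := by
    refine iUnion₂_subset fun z hz => union_subset (hCs z hz.1 hz.2) fun y hy => ⟨hy.1, ?_⟩
    exact fun hy' => disjoint_left.1 (hW.disjoint hz.1 hw hz.2) hy hy'
  have hFc : IsCompact F := (hW.1.subset sdiff_subset).isCompact_biUnion fun z hz =>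
    (hCc z hz.1 hz.2).union (isCompact_Vis z)
  have hFp : IsPreconnected F := by
    have : F = ⋃₀ ((fun z => C z ∪ P.Vis z) '' (W \ {w})) := by rw [sUnion_image]
    rw [this]
    refine isPreconnected_sUnion q _ ?_ ?_
    · rintro _ ⟨z, hz, rfl⟩
      exact Or.inl (hqC z hz.1 hz.2)
    · rintro _ ⟨z, hz, rfl⟩
      exact (hCp z hz.1 hz.2).union z (hzC z hz.1 hz.2) (mem_Vis_self (hW.2.1 hz.1))
        (isPreconnected_Vis z)
  by_contra! hcon
  obtain ⟨y, hyF, hy⟩ := Sees.of_forall_vertex hFc hFp (hFs.trans sdiff_subset) (fun i hi => by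
    obtain ⟨z, hz, hzw, hnd⟩ := hcon i hi
    obtain ⟨y, hyi, hyz⟩ := not_disjoint_iff.1 hnd
    exact ⟨y, mem_biUnion (⟨hz, hzw⟩ : z ∈ W \ {w}) (Or.inr hyz), hyi.2⟩) (hW.2.1 hw)
  exact (hFs hyF).2 (mem_Vis_iff.2 hy)

theorem IsWitnessSet.exchange {W : Set Plane} (hW : P.IsWitnessSet W) {v w : Plane}
    (hv : v ∈ P.region) (h : ∀ z ∈ W, z ≠ w → Disjoint (P.Vis v) (P.Vis z)) :
    P.IsWitnessSet (insert v (W \ {w})) := by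
  refine ⟨(hW.1.subset sdiff_subset).insert v,
    insert_subset hv (sdiff_subset.trans hW.2.1), ?_⟩
  rintro x (rfl | hx) y (rfl | hy) hxy
  · exact absurd rfl hxy
  · exact (h y hy.1 hy.2).inter_eq
  · exact (h x hx.1 hx.2).symm.inter_eq
  · exact hW.2.2 x hx.1 y hy.1 hxy

theorem IsWitnessSet.exists_exchange {W : Set Plane} (hW : P.IsWitnessSet W) (hne : W.Nonempty) :
    ∃ w ∈ W, ∃ i < P.n, ∀ z ∈ W, z ≠ w → Disjoint (P.Vis (P.vertex i)) (P.Vis z) := by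
  rcases hne.exists_eq_singleton_or_nontrivial with ⟨w, rfl⟩ | hW2
  · refine ⟨w, rfl, 0, by have := P.three_le; omega, ?_⟩
    rintro z rfl h
    exact absurd rfl h
  · obtain ⟨w, hw, q, hq⟩ := hW.exists_forall_joinedOffVis hW2
    exact ⟨w, hw, hW.exists_vertex_disjoint hw hq⟩

end SimplePolygon

/-- If a simple polygon has a witness set of size `k ≥ 1`, it has one of
size `k` containing a vertex of the polygon. -/
theorem witness_set_with_vertex (P : SimplePolygon) (k : ℕ) (hk : 1 ≤ k)
    (W : Set Plane) (hW : P.IsWitnessSet W) (hcard : W.ncard = k) :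
    ∃ W' : Set Plane, P.IsWitnessSet W' ∧ W'.ncard = k ∧
      ∃ i < P.n, P.vertex i ∈ W' := by
  have hne : W.Nonempty := by
    rw [nonempty_iff_ne_empty]
    rintro rfl
    rw [ncard_empty] at hcard
    omega
  obtain ⟨w, hw, i, hi, h⟩ := hW.exists_exchange hne
  have hv := P.vertex_mem_region hi
  refine ⟨_, hW.exchange hv h, ?_, i, hi, mem_insert _ _⟩
  rw [← hcard]
  by_cases hvW : P.vertex i ∈ W
  · have hvw : P.vertex i = w := by
      by_contra hne
      exact disjoint_left.1 (h _ hvW hne) (SimplePolygon.mem_Vis_self hv)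
        (SimplePolygon.mem_Vis_self hv)
    rw [hvw, insert_sdiff_singleton, insert_eq_of_mem hw]
  · exact ncard_exchange hvW hw
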